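/- arXiv:2310.09688 — 3 statements merged into one kernel-verified Lean document; each statement's English description precedes it below -/
import Mathlib

section
/- In the counterexample C-POMDP, the policy p* = (1,1,1) is optimal for the constrained problem: V_C(1,1,1) = 5 ≤ 5 and V_R(1,1,1) = 12, and every feasible policy p ∈ [0,1]³ satisfies V_R(p) ≤ 12. Moreover p* is the unique optimal policy: every feasible p with V_R(p) = 12 equals (1,1,1). -/
/-- Expected cumulative reward of the stochastic policy `p = (p0, p1, p2)`
in the counterexample C-POMDP. -/
noncomputable def VR (p : ℝ × ℝ × ℝ) : ℝ :=
  (1 - p.1) * 10 + p.1 * (0.5 * 12 * p.2.1 + 0.5 * 12 * p.2.2)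

/-- Expected cumulative cost of the stochastic policy `p = (p0, p1, p2)`. -/
noncomputable def VC (p : ℝ × ℝ × ℝ) : ℝ :=
  (1 - p.1) * 5 +
    p.1 * (0.5 * (8 * p.2.1 + 5 * (1 - p.2.1)) + 0.5 * (2 * p.2.2 + 5 * (1 - p.2.2)))

/-- `p` is a valid stochastic policy: each coordinate is a probability. -/
def IsPolicy (p : ℝ × ℝ × ℝ) : Prop :=
  p.1 ∈ Set.Icc (0 : ℝ) 1 ∧ p.2.1 ∈ Set.Icc (0 : ℝ) 1 ∧ p.2.2 ∈ Set.Icc (0 : ℝ) 1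

/-- Feasibility for the C-POMDP problem with threshold `ĉ = 5`. -/
def Feasible (p : ℝ × ℝ × ℝ) : Prop := IsPolicy p ∧ VC p ≤ 5

/-- The reward gap to `12`, as a combination of the probabilities of the actions `a_B`. -/
theorem twelve_sub_VR (a b c : ℝ) :
    12 - VR (a, b, c) = 2 * (1 - a) + 6 * (a * ((1 - b) + (1 - c))) := by
  simp only [VR]
  ring

/-- The policy `p* = (1,1,1)` is optimal for the constrained problem, and it is the
unique optimal policy. -/
theorem cpomdp_counterexample_optimal_policy :
    VC (1, 1, 1) = 5 ∧ VR (1, 1, 1) = 12 ∧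
    (∀ p, Feasible p → VR p ≤ 12) ∧
    (∀ p, Feasible p → VR p = 12 → p = (1, 1, 1)) := by
  refine ⟨by norm_num [VC], by norm_num [VR], ?_, ?_⟩
  · rintro ⟨a, b, c⟩ ⟨⟨⟨ha0, ha1⟩, ⟨-, hb1⟩, ⟨-, hc1⟩⟩, -⟩
    dsimp only at ha0 ha1 hb1 hc1
    have hgap := twelve_sub_VR a b c
    have hprod : 0 ≤ a * ((1 - b) + (1 - c)) := mul_nonneg ha0 (by linarith)
    linarith
  · rintro ⟨a, b, c⟩ ⟨⟨⟨ha0, ha1⟩, ⟨-, hb1⟩, ⟨-, hc1⟩⟩, -⟩ hV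
    dsimp only at ha0 ha1 hb1 hc1
    have hgap := twelve_sub_VR a b c
    have hprod : 0 ≤ a * ((1 - b) + (1 - c)) := mul_nonneg ha0 (by linarith)
    obtain rfl : a = 1 := by linarith
    obtain rfl : b = 1 := by linarith
    obtain rfl : c = 1 := by linarith
    rfl
end

section
/- Bellman's principle of optimality can fail for C-POMDPs (Theorem 1): in the counterexample C-POMDP, for every optimal policy p of the constrained problem (necessarily p = (1,1,1)), the value of p at belief b1 equals V_R^p(b1) = 12·p1 = 12, while the constrained Bellman backup of V^p at b1, namely B[V^p](b1) = max{ Q_R(b1,a) : a ∈ {a_A, a_B}, Q_C(b1,a) ≤ 5 }, equals 0; in particular B[V^p](b1) ≠ V_R^p(b1). -/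
/-- The two actions available at belief `b1`. -/
inductive CAct | aA | aB
  deriving DecidableEq

/-- Q-reward at belief `b1` (both actions lead to the terminal belief `b3`). -/
noncomputable def QR : CAct → ℝ
  | CAct.aA => 12
  | CAct.aB => 0

/-- Q-cost at belief `b1`. -/
noncomputable def QC : CAct → ℝ
  | CAct.aA => 8
  | CAct.aB => 5

/-- The constrained Bellman backup of `V^p` at belief `b1`:
the maximum Q-reward over actions whose Q-cost is within the threshold `ĉ = 5`. -/
noncomputable def backupB1 : ℝ :=
  sSup {x : ℝ | ∃ a : CAct, QC a ≤ 5 ∧ x = QR a}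

/-- The value of policy `p` at belief `b1`. -/
noncomputable def VRb1 (p : ℝ × ℝ × ℝ) : ℝ := 12 * p.2.1

theorem backupB1_eq_zero : backupB1 = 0 := by
  have h : {x : ℝ | ∃ a : CAct, QC a ≤ 5 ∧ x = QR a} = {0} := by
    ext x
    constructor
    · rintro ⟨a, ha, rfl⟩
      cases a
      · norm_num [QC] at ha
      · rfl
    · rintro rfl
      exact ⟨CAct.aB, le_rfl, rfl⟩
  rw [backupB1, h, csSup_singleton]

theorem feasible_one : Feasible (1, 1, 1) := by
  norm_num [Feasible, IsPolicy, VC]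

theorem VR_one : VR (1, 1, 1) = 12 := by
  norm_num [VR]

/-- `(1, 1, 1)` is the only policy whose expected cumulative reward reaches `12`. -/
theorem IsPolicy.eq_one_of_le_VR {p : ℝ × ℝ × ℝ} (hp : IsPolicy p) (h : 12 ≤ VR p) :
    p = (1, 1, 1) := by
  obtain ⟨x, a, b⟩ := p
  obtain ⟨⟨hx0, hx1⟩, ⟨-, ha1⟩, ⟨-, hb1⟩⟩ := hp
  norm_num [VR] at hx0 hx1 ha1 hb1 h
  have hxa := mul_nonneg hx0 (sub_nonneg.2 ha1)
  have hxb := mul_nonneg hx0 (sub_nonneg.2 hb1)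
  obtain rfl : x = 1 := by linarith
  obtain rfl : a = 1 := by linarith
  obtain rfl : b = 1 := by linarith
  rfl

/-- Bellman's principle of optimality fails in the counterexample C-POMDP:
for every optimal policy `p` of the constrained problem, the value of `p` at `b1`
equals `12`, while the constrained Bellman backup at `b1` equals `0`;
in particular the backup differs from the value of `p` at `b1`. -/
theorem cpomdp_bellman_optimality_fails :
    ∀ p, Feasible p → (∀ q, Feasible q → VR q ≤ VR p) →
      VRb1 p = 12 ∧ backupB1 = 0 ∧ backupB1 ≠ VRb1 p := by
  intro p hp hopt
  obtain rfl := hp.1.eq_one_of_le_VR (VR_one ▸ hopt _ feasible_one)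
  norm_num [VRb1, backupB1_eq_zero]
end

section
/- (Theorem 3, Bellman's principle of optimality for RC-POMDPs) Let V* be the unique fixed point of the constrained Bellman backup operator B, and let π : S → A be a policy with π(s) ∈ A'(s) for all s that is greedy with respect to V*, i.e., r s (π s) + γ·Σ_{s'} T s (π s) s'·V*(s') = (B V*)(s) for every s. Then the policy-evaluation operator B_π, defined by (B_π f)(s) = r s (π s) + γ·Σ_{s'} T s (π s) s'·f(s'), is a γ-contraction in the sup metric, and its unique fixed point V^π equals V*; consequently B[V^π](s) = V^π(s) for every s ∈ S, i.e., the greedy optimal policy satisfies the Bellman optimality criterion. -/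
/-- Averaging against a probability vector is nonexpansive for the sup metric. -/
theorem dist_sum_mul_le_of_sum_eq_one {S : Type*} [Fintype S] {p : S → ℝ}
    (hp0 : ∀ s, 0 ≤ p s) (hp1 : ∑ s, p s = 1) (f g : S → ℝ) :
    dist (∑ s, p s * f s) (∑ s, p s * g s) ≤ dist f g :=
  calc dist (∑ s, p s * f s) (∑ s, p s * g s)
      ≤ ∑ s, dist (p s * f s) (p s * g s) := dist_sum_sum_le _ _ _
    _ = ∑ s, p s * dist (f s) (g s) := by
        simp only [Real.dist_eq, ← mul_sub, abs_mul, abs_of_nonneg (hp0 _)]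
    _ ≤ ∑ s, p s * dist f g :=
        Finset.sum_le_sum fun s _ => mul_le_mul_of_nonneg_left (dist_le_pi_dist f g s) (hp0 s)
    _ = dist f g := by rw [← Finset.sum_mul, hp1, one_mul]

/-- A map that shrinks distances by a factor less than one has at most one fixed point. -/
theorem eq_of_fixed_of_dist_le_mul {X : Type*} [MetricSpace X] {F : X → X} {γ : ℝ} (hγ1 : γ < 1)
    (hF : ∀ x y, dist (F x) (F y) ≤ γ * dist x y) {x y : X} (hx : F x = x) (hy : F y = y) :
    x = y := by
  have h := hF x y
  rw [hx, hy] at h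
  exact dist_le_zero.mp (by nlinarith [dist_nonneg (x := x) (y := y)])


/-- (Theorem 3, Bellman's principle of optimality for RC-POMDPs) Let `B` be the
constrained Bellman backup on the augmented belief–admissible-cost states, `V*` its
fixed point, and `π` an admissible policy greedy with respect to `V*`. Then the
policy-evaluation operator `Bπ f s = r s (π s) + γ·Σ_{s'} T s (π s) s' · f s'` is a
`γ`-contraction in the sup metric, it has a unique fixed point, every fixed point
`V^π` of `Bπ` equals `V*`, and consequently `B[V^π] = V^π`, i.e., the greedy optimal
policy satisfies the Bellman optimality criterion. -/
theorem rcpomdp_bellman_principle_of_optimality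
    {S A : Type*} [Fintype S] [Fintype A] [Nonempty S] [Nonempty A]
    (γ : ℝ) (hγ0 : 0 ≤ γ) (hγ1 : γ < 1)
    (r : S → A → ℝ) (T : S → A → S → ℝ)
    (hT0 : ∀ s a s', 0 ≤ T s a s') (hT1 : ∀ s a, ∑ s', T s a s' = 1)
    (A' : S → Finset A) (hA' : ∀ s, (A' s).Nonempty)
    (B : (S → ℝ) → (S → ℝ))
    (hB : ∀ f s, B f s = (A' s).sup' (hA' s) (fun a => r s a + γ * ∑ s', T s a s' * f s'))
    (Vstar : S → ℝ) (hVstar : B Vstar = Vstar)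
    (π : S → A) (hπ : ∀ s, π s ∈ A' s)
    (hgreedy : ∀ s, r s (π s) + γ * ∑ s', T s (π s) s' * Vstar s' = B Vstar s)
    (Bπ : (S → ℝ) → (S → ℝ))
    (hBπ : ∀ f s, Bπ f s = r s (π s) + γ * ∑ s', T s (π s) s' * f s') :
    (∀ f g : S → ℝ, dist (Bπ f) (Bπ g) ≤ γ * dist f g) ∧
    (∃! V : S → ℝ, Bπ V = V) ∧
    (∀ Vπ : S → ℝ, Bπ Vπ = Vπ → Vπ = Vstar ∧ ∀ s, B Vπ s = Vπ s) := by
  have hcontr : ∀ f g : S → ℝ, dist (Bπ f) (Bπ g) ≤ γ * dist f g := by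
    intro f g
    refine (dist_pi_le_iff (by positivity)).mpr fun s => ?_
    rw [hBπ, hBπ, dist_add_left, Real.dist_eq, ← mul_sub, abs_mul, abs_of_nonneg hγ0,
      ← Real.dist_eq]
    exact mul_le_mul_of_nonneg_left
      (dist_sum_mul_le_of_sum_eq_one (hT0 s (π s)) (hT1 s (π s)) f g) hγ0
  have hfix : Bπ Vstar = Vstar := by
    funext s
    rw [hBπ, hgreedy, hVstar]
  have huniq : ∀ V, Bπ V = V → V = Vstar := fun V hV =>
    eq_of_fixed_of_dist_le_mul hγ1 hcontr hV hfix
  refine ⟨hcontr, ⟨Vstar, hfix, huniq⟩, fun V hV => ?_⟩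
  obtain rfl := huniq V hV
  exact ⟨rfl, congrFun hVstar⟩
end
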